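/- arXiv:2409.02677 — 2 statements merged into one kernel-verified Lean document; each statement's English description precedes it below -/
import Mathlib

section
/- Let A be a commutative K-algebra and V = Der_K(A). The K-vector space A ⊗ V with bracket [f⊗η, g⊗μ] = f·η(g)⊗μ − g·μ(f)⊗η + fg⊗[η,μ] is a Lie algebra. -/
open TensorProduct

namespace TensorDerivation

variable (K A : Type*) [CommRing K] [CommRing A] [Algebra K A]

/-- The anchor map `A ⊗ Der_K(A) → End_K(A)`, sending `f ⊗ η` to `f • η`. -/
noncomputable def anchor : A ⊗[K] Derivation K A A →ₗ[K] Module.End K A :=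
  TensorProduct.lift <| LinearMap.mk₂ K (fun f η => f • (η : A →ₗ[K] A))
    (fun f g η => add_smul f g _)
    (fun c f η => smul_assoc c f _)
    (fun f η μ => by ext; simp)
    (fun c f η => by ext; simp)

set_option maxSynthPendingDepth 5 in
/-- The bracket of the action Lie algebroid `A ⊗ Der_K(A)`. -/
noncomputable def bracket :
    A ⊗[K] Derivation K A A →ₗ[K] A ⊗[K] Derivation K A A →ₗ[K] A ⊗[K] Derivation K A A :=
  let p := LinearMap.rTensorHom (Derivation K A A) ∘ₗ anchor K A
  p - p.flip + TensorProduct.map₂ (LinearMap.mul K A)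
    (LieModule.toEnd K (Derivation K A A) (Derivation K A A) :
      Derivation K A A →ₗ[K] Module.End K (Derivation K A A))

variable {K A}

set_option maxSynthPendingDepth 5 in
theorem bracket_tmul (f g : A) (η μ : Derivation K A A) :
    bracket K A (f ⊗ₜ[K] η) (g ⊗ₜ[K] μ)
      = (f * η g) ⊗ₜ[K] μ - (g * μ f) ⊗ₜ[K] η + (f * g) ⊗ₜ[K] ⁅η, μ⁆ := by
  simp [bracket, anchor]

theorem bracket_antisymm (u v : A ⊗[K] Derivation K A A) :
    bracket K A u v = -bracket K A v u := by
  induction u with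
  | zero => simp
  | add u₁ u₂ h₁ h₂ => simp only [map_add, LinearMap.add_apply, h₁, h₂, neg_add]
  | tmul f η =>
    induction v with
    | zero => simp
    | add v₁ v₂ h₁ h₂ => simp only [map_add, LinearMap.add_apply, h₁, h₂, neg_add]
    | tmul g μ =>
      rw [bracket_tmul, bracket_tmul, ← lie_skew η μ, tmul_neg, mul_comm g f]
      abel

theorem bracket_leibniz_tmul (f g h : A) (η μ ν : Derivation K A A) :
    bracket K A (f ⊗ₜ[K] η) (bracket K A (g ⊗ₜ[K] μ) (h ⊗ₜ[K] ν))
      = bracket K A (bracket K A (f ⊗ₜ[K] η) (g ⊗ₜ[K] μ)) (h ⊗ₜ[K] ν)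
        + bracket K A (g ⊗ₜ[K] μ) (bracket K A (f ⊗ₜ[K] η) (h ⊗ₜ[K] ν)) := by
  simp only [bracket_tmul, map_add, map_sub, LinearMap.add_apply, LinearMap.sub_apply,
    Derivation.leibniz, Derivation.commutator_apply, smul_eq_mul, leibniz_lie η μ ν,
    ← lie_skew μ η, tmul_neg, tmul_add]
  simp only [mul_add, mul_sub, add_tmul, sub_tmul, mul_assoc, mul_comm, mul_left_comm]
  abel

theorem bracket_leibniz (u v w : A ⊗[K] Derivation K A A) :
    bracket K A u (bracket K A v w)
      = bracket K A (bracket K A u v) w + bracket K A v (bracket K A u w) := by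
  induction u with
  | zero => simp
  | add u₁ u₂ h₁ h₂ => simp only [map_add, LinearMap.add_apply, h₁, h₂]; abel
  | tmul f η =>
    induction v with
    | zero => simp
    | add v₁ v₂ h₁ h₂ => simp only [map_add, LinearMap.add_apply, h₁, h₂]; abel
    | tmul g μ =>
      induction w with
      | zero => simp
      | add w₁ w₂ h₁ h₂ => simp only [map_add, h₁, h₂]; abel
      | tmul h ν => exact bracket_leibniz_tmul f g h η μ ν

end TensorDerivation

/-- For a commutative `K`-algebra `A` with `V = Der_K(A)`, the bracket
`[f⊗η, g⊗μ] = f·η(g)⊗μ − g·μ(f)⊗η + fg⊗[η,μ]` gives `A ⊗_K V` the structure of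
a Lie algebra: the (well-defined, bilinear) bracket is antisymmetric and
satisfies the Jacobi identity (in Leibniz form). -/
theorem tensor_bracket_is_lie_algebra
    (K : Type*) [Field K] [CharZero K] (A : Type*) [CommRing A] [Algebra K A] :
    ∃ br : (A ⊗[K] Derivation K A A) →ₗ[K]
        (A ⊗[K] Derivation K A A) →ₗ[K] (A ⊗[K] Derivation K A A),
      (∀ (f g : A) (η μ : Derivation K A A),
        br (f ⊗ₜ[K] η) (g ⊗ₜ[K] μ)
          = (f * η g) ⊗ₜ[K] μ - (g * μ f) ⊗ₜ[K] η + (f * g) ⊗ₜ[K] ⁅η, μ⁆) ∧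
      (∀ u v, br u v = - br v u) ∧
      (∀ u v w, br u (br v w) = br (br u v) w + br v (br u w)) :=
  ⟨TensorDerivation.bracket K A, TensorDerivation.bracket_tmul,
    TensorDerivation.bracket_antisymm, TensorDerivation.bracket_leibniz⟩
end

section
/- Let W be a finite-dimensional module over the Lie algebra L̂_+ of vanishing-at-zero derivations of K[[X_1,...,X_n]]. Then there exists N ∈ ℕ such that m^N·L̂_+ (derivations with coefficients in m^{N+1}) annihilates W. -/
open MvPowerSeries

variable (K : Type*) [Field K] [CharZero K] [IsAlgClosed K] (n : ℕ)

/-- The maximal ideal `m = (X_1, ..., X_n)` of `K[[X_1,...,X_n]]`. -/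
noncomputable def mIdealMv : Ideal (MvPowerSeries (Fin n) K) :=
  Ideal.span (Set.range fun i : Fin n => (X i : MvPowerSeries (Fin n) K))

private lemma mem_m_stable
    (d : Derivation K (MvPowerSeries (Fin n) K) (MvPowerSeries (Fin n) K))
    (hd : ∀ i, d (X i) ∈ mIdealMv K n) :
    ∀ f ∈ mIdealMv K n, d f ∈ mIdealMv K n := by
  intro f hf
  induction hf using Submodule.span_induction with
  | mem x hx => obtain ⟨i, rfl⟩ := hx; exact hd i
  | zero => simp only [map_zero]; exact Submodule.zero_mem _
  | add x y _ _ hx hy => simpa only [map_add] using add_mem hx hy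
  | smul r x hxmem hx =>
      rw [smul_eq_mul, Derivation.leibniz, smul_eq_mul, smul_eq_mul]
      exact add_mem (Ideal.mul_mem_left _ _ hx) (Ideal.mul_mem_right _ _ hxmem)

/-- The Lie algebra `L̂_+` of vanishing-at-zero derivations of `K[[X_1,...,X_n]]`,
as a Lie subalgebra of `Der K[[X_1,...,X_n]]`. -/
noncomputable def LhatPlusLie :
    LieSubalgebra K
      (Derivation K (MvPowerSeries (Fin n) K) (MvPowerSeries (Fin n) K)) where
  carrier := {d | ∀ i, d (X i) ∈ mIdealMv K n}
  add_mem' := by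
    intro d e hd he i
    simpa using add_mem (hd i) (he i)
  smul_mem' := by
    intro c d hd i
    simpa using Submodule.smul_mem ((mIdealMv K n).restrictScalars K) c (hd i)
  zero_mem' := by
    intro i
    simp only [Derivation.coe_zero, Pi.zero_apply]
    exact Submodule.zero_mem (mIdealMv K n)
  lie_mem' := by
    intro d e hd he i
    rw [Derivation.commutator_apply]
    exact sub_mem (mem_m_stable K n d hd _ (he i)) (mem_m_stable K n e he _ (hd i))

/-- The Euler derivation `∑ i, X_i ∂/∂X_i` of `K[[X_1,...,X_n]]`. -/
noncomputable def eulerDerivation :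
    Derivation K (MvPowerSeries (Fin n) K) (MvPowerSeries (Fin n) K) :=
  ∑ i, (X i : MvPowerSeries (Fin n) K) • pderiv K i

variable {K n}

omit [CharZero K] [IsAlgClosed K] in
lemma eulerDerivation_apply (f : MvPowerSeries (Fin n) K) :
    eulerDerivation K n f = ∑ i, X i * pderiv K i f := by
  simp only [eulerDerivation, ← Derivation.coeFnAddMonoidHom_apply, map_sum, Finset.sum_apply]
  rfl

omit [CharZero K] [IsAlgClosed K] in
lemma coeff_X_mul_pderiv (i : Fin n) (f : MvPowerSeries (Fin n) K) (α : Fin n →₀ ℕ) :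
    coeff α (X i * pderiv K i f) = α i * coeff α f := by
  rw [X_def, coeff_monomial_mul]
  split_ifs with h
  · have hi : 1 ≤ α i := by simpa using h i
    rw [coeff_pderiv, tsub_add_cancel_of_le h, one_mul, mul_comm]
    congr 1
    simp [Nat.cast_sub hi]
  · have hi : α i = 0 := by
      by_contra hi
      exact h (Finsupp.single_le_iff.2 (Nat.one_le_iff_ne_zero.2 hi))
    simp [hi]

omit [CharZero K] [IsAlgClosed K] in
lemma coeff_eulerDerivation (f : MvPowerSeries (Fin n) K) (α : Fin n →₀ ℕ) :
    coeff α (eulerDerivation K n f) = (α.degree : K) * coeff α f := by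
  rw [eulerDerivation_apply, map_sum]
  simp only [coeff_X_mul_pderiv]
  rw [← Finset.sum_mul, Finsupp.degree_eq_sum, Nat.cast_sum]

omit [IsAlgClosed K] in
lemma mem_mIdealMv_iff (f : MvPowerSeries (Fin n) K) :
    f ∈ mIdealMv K n ↔ constantCoeff f = 0 := by
  constructor
  · intro hf
    have hle : mIdealMv K n ≤ RingHom.ker (constantCoeff (σ := Fin n) (R := K)) :=
      Ideal.span_le.2 (by rintro _ ⟨i, rfl⟩; simp [RingHom.mem_ker])
    exact hle hf
  · intro hf
    let h : MvPowerSeries (Fin n) K := fun α => (α.degree : K)⁻¹ * coeff α f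
    have hh : f = eulerDerivation K n h := by
      ext α
      rw [coeff_eulerDerivation, show coeff α h = (α.degree : K)⁻¹ * coeff α f from rfl]
      by_cases hα : α = 0
      · subst hα
        simpa using hf
      · rw [mul_inv_cancel_left₀]
        exact Nat.cast_ne_zero.2 fun h0 => hα ((Finsupp.degree_eq_zero_iff α).1 h0)
    rw [hh, eulerDerivation_apply]
    exact sum_mem fun i _ => Ideal.mul_mem_right _ _ (Ideal.subset_span ⟨i, rfl⟩)

omit [IsAlgClosed K] in
lemma le_order_of_mem_mIdealMv_pow (k : ℕ) (f : MvPowerSeries (Fin n) K)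
    (hf : f ∈ mIdealMv K n ^ k) : (k : ℕ∞) ≤ f.order := by
  induction k generalizing f with
  | zero => simp
  | succ k ih =>
    rw [pow_succ] at hf
    induction hf using Submodule.mul_induction_on' with
    | mem_mul_mem a ha b hb =>
      refine le_trans ?_ le_order_mul
      push_cast
      exact add_le_add (ih a ha)
        (one_le_order_iff_constCoeff_eq_zero.2 ((mem_mIdealMv_iff b).1 hb))
    | add a _ b _ ha hb => exact (le_min ha hb).trans min_order_le_add

omit [IsAlgClosed K] in
lemma derivation_mem_mIdealMv_pow
    (D : Derivation K (MvPowerSeries (Fin n) K) (MvPowerSeries (Fin n) K))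
    (hD : ∀ i, D (X i) = 0) (k : ℕ) (f : MvPowerSeries (Fin n) K) :
    D f ∈ mIdealMv K n ^ k := by
  induction k generalizing f with
  | zero => simp
  | succ k ih =>
    have key : ∀ g ∈ mIdealMv K n, D g ∈ mIdealMv K n ^ (k + 1) := by
      intro g hg
      induction hg using Submodule.span_induction with
      | mem x hx => obtain ⟨i, rfl⟩ := hx; simp [hD]
      | zero => simp
      | add x y _ _ hx hy => simpa using add_mem hx hy
      | smul r x hx hDx =>
        rw [smul_eq_mul, Derivation.leibniz, smul_eq_mul, smul_eq_mul, pow_succ']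
        rw [pow_succ'] at hDx
        exact add_mem (Ideal.mul_mem_left _ _ hDx) (Ideal.mul_mem_mul hx (ih r))
    have hf : D f = D (f - algebraMap K _ (constantCoeff f)) := by simp
    rw [hf]
    exact key _ ((mem_mIdealMv_iff _).2 (by simp [← c_eq_algebraMap]))

omit [IsAlgClosed K] in
/-- A derivation of a power series ring is determined by its values on the variables. -/
lemma derivation_mvPowerSeries_ext
    {D D' : Derivation K (MvPowerSeries (Fin n) K) (MvPowerSeries (Fin n) K)}
    (h : ∀ i, D (X i) = D' (X i)) : D = D' := by
  ext1 f
  rw [← sub_eq_zero, ← Derivation.sub_apply]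
  have : IsHausdorff (mIdealMv K n) (MvPowerSeries (Fin n) K) :=
    (inferInstance : IsAdicComplete (Ideal.span (Set.range X))
      (MvPowerSeries (Fin n) K)).toIsHausdorff
  refine IsHausdorff.haus this _ fun k => ?_
  rw [SModEq.zero, smul_eq_mul, Ideal.mul_top]
  exact derivation_mem_mIdealMv_pow _ (fun i => by simp [h]) k f

/-- The derivation of `K[[X_1,...,X_n]]` with prescribed values on the variables. -/
noncomputable def derivationOfCoeffs (f : Fin n → MvPowerSeries (Fin n) K) :
    Derivation K (MvPowerSeries (Fin n) K) (MvPowerSeries (Fin n) K) :=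
  ∑ i, f i • pderiv K i

omit [CharZero K] [IsAlgClosed K] in
lemma derivationOfCoeffs_X (f : Fin n → MvPowerSeries (Fin n) K) (j : Fin n) :
    derivationOfCoeffs f (X j) = f j := by
  classical
  have : derivationOfCoeffs f (X j) = ∑ i, f i * pderiv K i (X j) := by
    simp only [derivationOfCoeffs, ← Derivation.coeFnAddMonoidHom_apply, map_sum,
      Finset.sum_apply]
    rfl
  rw [this, Finset.sum_eq_single j]
  · simp
  · intro i _ hij
    rw [pderiv_X_of_ne hij.symm, mul_zero]
  · simp

variable (K n) in
/-- The Euler derivation as an element of `L̂_+`. -/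
noncomputable def eulerLhatPlus : LhatPlusLie K n :=
  ⟨eulerDerivation K n, fun i => (mem_mIdealMv_iff _).2 (by
    rw [← coeff_zero_eq_constantCoeff_apply, coeff_eulerDerivation]; simp)⟩

lemma coeff_ad_eulerLhatPlus (e : LhatPlusLie K n) (i : Fin n) (α : Fin n →₀ ℕ) :
    coeff α ((LieAlgebra.ad K _ (eulerLhatPlus K n) e).1 (X i)) =
      ((α.degree : K) - 1) * coeff α (e.1 (X i)) := by
  have hX : eulerDerivation K n (X i) = X i := derivationOfCoeffs_X _ i
  rw [LieAlgebra.ad_apply, LieSubalgebra.coe_bracket, Derivation.commutator_apply]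
  simp only [eulerLhatPlus]
  rw [hX, map_sub, coeff_eulerDerivation, sub_one_mul]

lemma coeff_aeval_ad_eulerLhatPlus (p : Polynomial K) (e : LhatPlusLie K n) (i : Fin n)
    (α : Fin n →₀ ℕ) :
    coeff α ((Polynomial.aeval (LieAlgebra.ad K _ (eulerLhatPlus K n)) p e).1 (X i)) =
      p.eval ((α.degree : K) - 1) * coeff α (e.1 (X i)) := by
  induction p using Polynomial.induction_on' generalizing e with
  | add p q hp hq => simp [hp, hq, add_mul]
  | monomial k c =>
    rw [Polynomial.aeval_monomial, Polynomial.eval_monomial]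
    induction k generalizing e with
    | zero => simp
    | succ k ih =>
      rw [pow_succ, ← mul_assoc, Module.End.mul_apply, ih, coeff_ad_eulerLhatPlus]
      ring

/-- If `p` has no root at any natural number `≥ N`, then `p (ad E)` is surjective onto the
derivations with coefficients in `m ^ (N + 1)`. -/
lemma exists_aeval_ad_eulerLhatPlus_eq (p : Polynomial K) (N : ℕ)
    (hp : ∀ k : ℕ, N ≤ k → p.eval (k : K) ≠ 0) (d : LhatPlusLie K n)
    (hd : ∀ i, d.1 (X i) ∈ mIdealMv K n ^ (N + 1)) :
    ∃ e, Polynomial.aeval (LieAlgebra.ad K _ (eulerLhatPlus K n)) p e = d := by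
  let f : Fin n → MvPowerSeries (Fin n) K := fun i α =>
    (p.eval ((α.degree : K) - 1))⁻¹ * coeff α (d.1 (X i))
  have hf (i : Fin n) (α : Fin n →₀ ℕ) :
      coeff α (f i) = (p.eval ((α.degree : K) - 1))⁻¹ * coeff α (d.1 (X i)) := rfl
  have hmem : ∀ i, derivationOfCoeffs f (X i) ∈ mIdealMv K n := fun i => by
    have h0 := (mem_mIdealMv_iff _).1 (d.2 i)
    rw [mem_mIdealMv_iff, derivationOfCoeffs_X, ← coeff_zero_eq_constantCoeff_apply, hf,
      coeff_zero_eq_constantCoeff_apply, h0, mul_zero]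
  refine ⟨⟨derivationOfCoeffs f, hmem⟩, Subtype.ext (derivation_mvPowerSeries_ext fun i => ?_)⟩
  ext α
  rw [coeff_aeval_ad_eulerLhatPlus, derivationOfCoeffs_X, hf]
  by_cases hα : α.degree < N + 1
  · have h0 : coeff α (d.1 (X i)) = 0 := coeff_of_lt_order
      (lt_of_lt_of_le (by exact_mod_cast hα) (le_order_of_mem_mIdealMv_pow _ _ (hd i)))
    rw [h0, mul_zero, mul_zero]
  · obtain ⟨k, hk⟩ : ∃ k, α.degree = k + 1 := ⟨α.degree - 1, by omega⟩
    refine mul_inv_cancel_left₀ ?_ _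
    rw [hk, Nat.cast_succ, add_sub_cancel_right]
    exact hp k (by omega)

omit [CharZero K] [IsAlgClosed K] in
lemma map_aeval_ad_apply {L L' : Type*} [LieRing L] [LieAlgebra K L] [LieRing L']
    [LieAlgebra K L'] (φ : L →ₗ⁅K⁆ L') (x y : L) (p : Polynomial K) :
    φ (Polynomial.aeval (LieAlgebra.ad K L x) p y) =
      Polynomial.aeval (LieAlgebra.ad K L' (φ x)) p (φ y) := by
  induction p using Polynomial.induction_on' generalizing y with
  | add p q hp hq => simp [hp, hq]
  | monomial k c =>
    rw [Polynomial.aeval_monomial, Polynomial.aeval_monomial]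
    induction k generalizing y with
    | zero => simp
    | succ k ih =>
      rw [pow_succ, pow_succ, ← mul_assoc, ← mul_assoc, Module.End.mul_apply, ih,
        LieAlgebra.ad_apply, LieHom.map_lie, ← LieAlgebra.ad_apply (R := K)]
      rfl

omit [IsAlgClosed K] in
lemma exists_forall_le_eval_natCast_ne_zero {p : Polynomial K} (hp : p ≠ 0) :
    ∃ N : ℕ, ∀ k : ℕ, N ≤ k → p.eval (k : K) ≠ 0 := by
  have hfin : {k : ℕ | p.IsRoot (k : K)}.Finite :=
    (Polynomial.finite_setOfPred_isRoot hp).preimage Nat.cast_injective.injOn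
  obtain ⟨M, hM⟩ := hfin.bddAbove
  exact ⟨M + 1, fun k hk h0 => absurd (hM h0) (by omega)⟩

variable (K n)

/-- Let `W` be a finite-dimensional module over `L̂_+`. Then there is `N` such
that `m^N·L̂_+` (the derivations whose coefficients lie in `m^(N+1)`)
annihilates `W`. -/
theorem exists_power_annihilates
    (W : Type*) [AddCommGroup W] [Module K W]
    [LieRingModule (LhatPlusLie K n) W] [LieModule K (LhatPlusLie K n) W]
    [FiniteDimensional K W] :
    ∃ N : ℕ, ∀ d : LhatPlusLie K n,
      (∀ i, (d : Derivation K (MvPowerSeries (Fin n) K) (MvPowerSeries (Fin n) K)) (X i)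
        ∈ (mIdealMv K n) ^ (N + 1)) →
      ∀ w : W, ⁅d, w⁆ = 0 := by
  let : LieRing (Module.End K W) := LieRing.ofAssociativeRing
  let ρ := LieModule.toEnd K (LhatPlusLie K n) W
  let A := LieAlgebra.ad K (Module.End K W) (ρ (eulerLhatPlus K n))
  obtain ⟨N, hN⟩ := exists_forall_le_eval_natCast_ne_zero
    (minpoly.ne_zero (Algebra.IsIntegral.isIntegral (R := K) A))
  refine ⟨N, fun d hd w => ?_⟩
  obtain ⟨e, rfl⟩ := exists_aeval_ad_eulerLhatPlus_eq _ N hN d hd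
  have h := map_aeval_ad_apply ρ (eulerLhatPlus K n) e (minpoly K A)
  rw [minpoly.aeval K A, LinearMap.zero_apply] at h
  exact LinearMap.congr_fun h w
end
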